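/- arXiv:math/0411155 — 2 statements merged into one kernel-verified Lean document; each statement's English description precedes it below -/
import Mathlib

section
/- Let J_{n,R} denote the two-sided ideal of W_{n,R} generated by e_{n−1} (n ≥ 2). Then: (1) J_{n,R} equals the two-sided ideal of W_{n,R} generated by {e_1, …, e_{n−1}}; (2) the quotient algebra W_{n,R}/J_{n,R} is isomorphic as an R-algebra to the Hecke algebra presented by generators g_i, g_i⁻¹ (1 ≤ i ≤ n−1) with relations g_i g_i⁻¹ = g_i⁻¹ g_i = 1, the braid relations g_i g_{i+1} g_i = g_{i+1} g_i g_{i+1} and g_i g_j = g_j g_i for |i−j| ≥ 2, and the quadratic relation g_i² = 1 − z g_i. -/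
namespace BMW

/-- Generators of the Birman–Wenzl–Murakami algebra `W_{n,R}`:
`g i`, `g i`⁻¹ and `e i` for `1 ≤ i ≤ n - 1`. -/
inductive Gen (n : ℕ) : Type where
  | g (i : ℕ) (h : 1 ≤ i ∧ i < n) : Gen n
  | gi (i : ℕ) (h : 1 ≤ i ∧ i < n) : Gen n
  | e (i : ℕ) (h : 1 ≤ i ∧ i < n) : Gen n

variable (R : Type*) [CommRing R]

/-- The generator `g i` in the free algebra (junk value `1` if `i` is out of range). -/
noncomputable def FG (n i : ℕ) : FreeAlgebra R (Gen n) :=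
  if h : 1 ≤ i ∧ i < n then FreeAlgebra.ι R (Gen.g i h) else 1

/-- The generator `g i⁻¹` in the free algebra (junk value `1` if `i` is out of range). -/
noncomputable def FGi (n i : ℕ) : FreeAlgebra R (Gen n) :=
  if h : 1 ≤ i ∧ i < n then FreeAlgebra.ι R (Gen.gi i h) else 1

/-- The generator `e i` in the free algebra (junk value `1` if `i` is out of range). -/
noncomputable def FE (n i : ℕ) : FreeAlgebra R (Gen n) :=
  if h : 1 ≤ i ∧ i < n then FreeAlgebra.ι R (Gen.e i h) else 1

/-- The defining relations of the Birman–Wenzl–Murakami algebra `W_{n,R}`. -/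
inductive Rel (lam laminv del z : R) (n : ℕ) :
    FreeAlgebra R (Gen n) → FreeAlgebra R (Gen n) → Prop where
  | inv_right (i : ℕ) (h : 1 ≤ i ∧ i < n) :
      Rel lam laminv del z n (FG R n i * FGi R n i) 1
  | inv_left (i : ℕ) (h : 1 ≤ i ∧ i < n) :
      Rel lam laminv del z n (FGi R n i * FG R n i) 1
  | idem (i : ℕ) (h : 1 ≤ i ∧ i < n) :
      Rel lam laminv del z n (FE R n i * FE R n i) (del • FE R n i)
  | braid (i : ℕ) (h : 1 ≤ i ∧ i + 1 < n) :
      Rel lam laminv del z n (FG R n i * FG R n (i + 1) * FG R n i)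
        (FG R n (i + 1) * FG R n i * FG R n (i + 1))
  | comm_gg (i j : ℕ) (h : 1 ≤ i ∧ 1 ≤ j ∧ i < n ∧ j < n ∧ (i + 2 ≤ j ∨ j + 2 ≤ i)) :
      Rel lam laminv del z n (FG R n i * FG R n j) (FG R n j * FG R n i)
  | comm_ge (i j : ℕ) (h : 1 ≤ i ∧ 1 ≤ j ∧ i < n ∧ j < n ∧ (i + 2 ≤ j ∨ j + 2 ≤ i)) :
      Rel lam laminv del z n (FG R n i * FE R n j) (FE R n j * FG R n i)
  | comm_ee (i j : ℕ) (h : 1 ≤ i ∧ 1 ≤ j ∧ i < n ∧ j < n ∧ (i + 2 ≤ j ∨ j + 2 ≤ i)) :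
      Rel lam laminv del z n (FE R n i * FE R n j) (FE R n j * FE R n i)
  | tangle_eee_up (i : ℕ) (h : 1 ≤ i ∧ i + 1 < n) :
      Rel lam laminv del z n (FE R n i * FE R n (i + 1) * FE R n i) (FE R n i)
  | tangle_eee_down (i : ℕ) (h : 1 ≤ i ∧ i + 1 < n) :
      Rel lam laminv del z n (FE R n (i + 1) * FE R n i * FE R n (i + 1)) (FE R n (i + 1))
  | tangle_gge_up (i : ℕ) (h : 1 ≤ i ∧ i + 1 < n) :
      Rel lam laminv del z n (FG R n i * FG R n (i + 1) * FE R n i)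
        (FE R n (i + 1) * FE R n i)
  | tangle_gge_down (i : ℕ) (h : 1 ≤ i ∧ i + 1 < n) :
      Rel lam laminv del z n (FG R n (i + 1) * FG R n i * FE R n (i + 1))
        (FE R n i * FE R n (i + 1))
  | tangle_egg_up (i : ℕ) (h : 1 ≤ i ∧ i + 1 < n) :
      Rel lam laminv del z n (FE R n i * FG R n (i + 1) * FG R n i)
        (FE R n i * FE R n (i + 1))
  | tangle_egg_down (i : ℕ) (h : 1 ≤ i ∧ i + 1 < n) :
      Rel lam laminv del z n (FE R n (i + 1) * FG R n i * FG R n (i + 1))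
        (FE R n (i + 1) * FE R n i)
  | skein (i : ℕ) (h : 1 ≤ i ∧ i < n) :
      Rel lam laminv del z n (FG R n i - FGi R n i) (z • (FE R n i - 1))
  | untwist_ge (i : ℕ) (h : 1 ≤ i ∧ i < n) :
      Rel lam laminv del z n (FG R n i * FE R n i) (laminv • FE R n i)
  | untwist_eg (i : ℕ) (h : 1 ≤ i ∧ i < n) :
      Rel lam laminv del z n (FE R n i * FG R n i) (laminv • FE R n i)
  | untwist_ege_up (i : ℕ) (h : 1 ≤ i ∧ i + 1 < n) :
      Rel lam laminv del z n (FE R n i * FG R n (i + 1) * FE R n i) (lam • FE R n i)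
  | untwist_ege_down (i : ℕ) (h : 1 ≤ i ∧ i + 1 < n) :
      Rel lam laminv del z n (FE R n (i + 1) * FG R n i * FE R n (i + 1))
        (lam • FE R n (i + 1))

/-- The Birman–Wenzl–Murakami algebra `W_{n,R}`, presented by generators and relations. -/
abbrev Alg (lam laminv del z : R) (n : ℕ) : Type _ :=
  RingQuot (Rel R lam laminv del z n)

variable (lam laminv del z : R) (n : ℕ)

/-- The generator `g i` of `W_{n,R}`. -/
noncomputable def g (i : ℕ) : Alg R lam laminv del z n :=
  RingQuot.mkAlgHom R (Rel R lam laminv del z n) (FG R n i)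

/-- The generator `g i⁻¹` of `W_{n,R}`. -/
noncomputable def gi (i : ℕ) : Alg R lam laminv del z n :=
  RingQuot.mkAlgHom R (Rel R lam laminv del z n) (FGi R n i)

/-- The generator `e i` of `W_{n,R}`. -/
noncomputable def e (i : ℕ) : Alg R lam laminv del z n :=
  RingQuot.mkAlgHom R (Rel R lam laminv del z n) (FE R n i)

end BMW

namespace Hecke

/-- Generators of the Hecke algebra: `g i`, `g i⁻¹` for `1 ≤ i ≤ n - 1`. -/
inductive Gen (n : ℕ) : Type where
  | g (i : ℕ) (h : 1 ≤ i ∧ i < n) : Gen n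
  | gi (i : ℕ) (h : 1 ≤ i ∧ i < n) : Gen n

variable (R : Type*) [CommRing R]

noncomputable def HG (n i : ℕ) : FreeAlgebra R (Gen n) :=
  if h : 1 ≤ i ∧ i < n then FreeAlgebra.ι R (Gen.g i h) else 1

noncomputable def HGi (n i : ℕ) : FreeAlgebra R (Gen n) :=
  if h : 1 ≤ i ∧ i < n then FreeAlgebra.ι R (Gen.gi i h) else 1

/-- The defining relations of the Hecke algebra: invertibility, braid relations and
the quadratic relation `g_i² = 1 - z g_i`. -/
inductive Rel (z : R) (n : ℕ) :
    FreeAlgebra R (Gen n) → FreeAlgebra R (Gen n) → Prop where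
  | inv_right (i : ℕ) (h : 1 ≤ i ∧ i < n) : Rel z n (HG R n i * HGi R n i) 1
  | inv_left (i : ℕ) (h : 1 ≤ i ∧ i < n) : Rel z n (HGi R n i * HG R n i) 1
  | braid (i : ℕ) (h : 1 ≤ i ∧ i + 1 < n) :
      Rel z n (HG R n i * HG R n (i + 1) * HG R n i)
        (HG R n (i + 1) * HG R n i * HG R n (i + 1))
  | comm (i j : ℕ) (h : 1 ≤ i ∧ 1 ≤ j ∧ i < n ∧ j < n ∧ (i + 2 ≤ j ∨ j + 2 ≤ i)) :
      Rel z n (HG R n i * HG R n j) (HG R n j * HG R n i)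
  | quad (i : ℕ) (h : 1 ≤ i ∧ i < n) :
      Rel z n (HG R n i * HG R n i) (1 - z • HG R n i)

/-- The Hecke algebra, presented by generators and relations. -/
abbrev Alg (z : R) (n : ℕ) : Type _ := RingQuot (Rel R z n)

noncomputable def hg (z : R) (n i : ℕ) : Alg R z n :=
  RingQuot.mkAlgHom R (Rel R z n) (HG R n i)

noncomputable def hgi (z : R) (n i : ℕ) : Alg R z n :=
  RingQuot.mkAlgHom R (Rel R z n) (HGi R n i)

end Hecke

namespace BMW

section HeckeQuotient

variable {R : Type*} [CommRing R] {lam laminv del z : R} {n : ℕ}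

/-- A relation of the presentation gives an equality in `W_{n,R}`. -/
theorem mk_eq_of_rel {x y : FreeAlgebra R (Gen n)} (h : Rel R lam laminv del z n x y) :
    RingQuot.mkAlgHom R (Rel R lam laminv del z n) x =
      RingQuot.mkAlgHom R (Rel R lam laminv del z n) y :=
  RingQuot.mkAlgHom_rel R h

/-- Every `e i` lies in the two-sided ideal generated by `e (n - 1)`. -/
theorem e_mem_span_e_last {i : ℕ} (h1 : 1 ≤ i) (hi : i < n) :
    e R lam laminv del z n i ∈ TwoSidedIdeal.span {e R lam laminv del z n (n - 1)} := by
  have hle : i ≤ n - 1 := Nat.le_sub_one_of_lt hi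
  induction hle using Nat.decreasingInduction with
  | self => exact TwoSidedIdeal.subset_span rfl
  | of_succ i hlt ih =>
    have hrel : e R lam laminv del z n i * e R lam laminv del z n (i + 1) *
        e R lam laminv del z n i = e R lam laminv del z n i := by
      simpa only [map_mul] using! mk_eq_of_rel (lam := lam) (laminv := laminv) (del := del)
        (z := z) (Rel.tangle_eee_up (n := n) i ⟨h1, by omega⟩)
    rw [← hrel]
    exact TwoSidedIdeal.mul_mem_right _ _ _
      (TwoSidedIdeal.mul_mem_left _ _ _ (ih (by omega) (by omega)))

/-- The two-sided ideal generated by `e (n - 1)` contains, and hence equals, the one generated by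
all the `e i`. -/
theorem span_e_last_eq_span_e (hn : 2 ≤ n) :
    TwoSidedIdeal.span {e R lam laminv del z n (n - 1)} =
      TwoSidedIdeal.span {y : Alg R lam laminv del z n | ∃ i : ℕ, 1 ≤ i ∧ i < n ∧
        y = e R lam laminv del z n i} := by
  apply le_antisymm
  · refine TwoSidedIdeal.span_mono ?_
    rintro _ rfl
    exact ⟨n - 1, by omega, by omega, rfl⟩
  · rw [TwoSidedIdeal.span_le]
    rintro _ ⟨i, h1, hi, rfl⟩
    exact e_mem_span_e_last h1 hi

theorem g_mul_gi {i : ℕ} (h : 1 ≤ i ∧ i < n) :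
    g R lam laminv del z n i * gi R lam laminv del z n i = 1 := by
  simpa only [map_mul, map_one] using! mk_eq_of_rel (Rel.inv_right i h)

theorem gi_mul_g {i : ℕ} (h : 1 ≤ i ∧ i < n) :
    gi R lam laminv del z n i * g R lam laminv del z n i = 1 := by
  simpa only [map_mul, map_one] using! mk_eq_of_rel (Rel.inv_left i h)

theorem g_braid {i : ℕ} (h : 1 ≤ i ∧ i + 1 < n) :
    g R lam laminv del z n i * g R lam laminv del z n (i + 1) * g R lam laminv del z n i =
      g R lam laminv del z n (i + 1) * g R lam laminv del z n i *
        g R lam laminv del z n (i + 1) := by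
  simpa only [map_mul] using! mk_eq_of_rel (Rel.braid i h)

theorem g_comm {i j : ℕ} (h : 1 ≤ i ∧ 1 ≤ j ∧ i < n ∧ j < n ∧ (i + 2 ≤ j ∨ j + 2 ≤ i)) :
    g R lam laminv del z n i * g R lam laminv del z n j =
      g R lam laminv del z n j * g R lam laminv del z n i := by
  simpa only [map_mul] using! mk_eq_of_rel (Rel.comm_gg i j h)

theorem g_sub_gi {i : ℕ} (h : 1 ≤ i ∧ i < n) :
    g R lam laminv del z n i - gi R lam laminv del z n i =
      z • (e R lam laminv del z n i - 1) := by
  simpa only [map_sub, map_smul, map_one] using! mk_eq_of_rel (Rel.skein i h)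

theorem hg_mul_hgi {i : ℕ} (h : 1 ≤ i ∧ i < n) :
    Hecke.hg R z n i * Hecke.hgi R z n i = 1 := by
  simpa only [map_mul, map_one] using!
    RingQuot.mkAlgHom_rel R (Hecke.Rel.inv_right (z := z) i h)

theorem hgi_mul_hg {i : ℕ} (h : 1 ≤ i ∧ i < n) :
    Hecke.hgi R z n i * Hecke.hg R z n i = 1 := by
  simpa only [map_mul, map_one] using!
    RingQuot.mkAlgHom_rel R (Hecke.Rel.inv_left (z := z) i h)

theorem hg_braid {i : ℕ} (h : 1 ≤ i ∧ i + 1 < n) :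
    Hecke.hg R z n i * Hecke.hg R z n (i + 1) * Hecke.hg R z n i =
      Hecke.hg R z n (i + 1) * Hecke.hg R z n i * Hecke.hg R z n (i + 1) := by
  simpa only [map_mul] using! RingQuot.mkAlgHom_rel R (Hecke.Rel.braid (z := z) i h)

theorem hg_comm {i j : ℕ} (h : 1 ≤ i ∧ 1 ≤ j ∧ i < n ∧ j < n ∧ (i + 2 ≤ j ∨ j + 2 ≤ i)) :
    Hecke.hg R z n i * Hecke.hg R z n j = Hecke.hg R z n j * Hecke.hg R z n i := by
  simpa only [map_mul] using! RingQuot.mkAlgHom_rel R (Hecke.Rel.comm (z := z) i j h)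

theorem hg_mul_hg {i : ℕ} (h : 1 ≤ i ∧ i < n) :
    Hecke.hg R z n i * Hecke.hg R z n i = 1 - z • Hecke.hg R z n i := by
  simpa only [map_mul, map_sub, map_smul, map_one] using!
    RingQuot.mkAlgHom_rel R (Hecke.Rel.quad (z := z) i h)

/-- The quadratic relation of the Hecke algebra in skein form. -/
theorem hg_sub_hgi {i : ℕ} (h : 1 ≤ i ∧ i < n) :
    Hecke.hg R z n i - Hecke.hgi R z n i = -(z • 1) := by
  have hq := congrArg (· * Hecke.hgi R z n i) (hg_mul_hg (z := z) h)
  simp only [mul_assoc, sub_mul, one_mul, smul_mul_assoc, hg_mul_hgi h, mul_one] at hq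
  rw [hq]
  abel

variable (R z n) in
/-- The map from the free algebra to the Hecke algebra killing every `e i`. -/
noncomputable def freeToHecke : FreeAlgebra R (Gen n) →ₐ[R] Hecke.Alg R z n :=
  FreeAlgebra.lift R fun
    | .g i _ => Hecke.hg R z n i
    | .gi i _ => Hecke.hgi R z n i
    | .e _ _ => 0

theorem freeToHecke_FG (i : ℕ) : freeToHecke R z n (FG R n i) = Hecke.hg R z n i := by
  by_cases h : 1 ≤ i ∧ i < n
  · simp [freeToHecke, FG, h]
  · simp [FG, Hecke.hg, Hecke.HG, h]

theorem freeToHecke_FGi (i : ℕ) : freeToHecke R z n (FGi R n i) = Hecke.hgi R z n i := by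
  by_cases h : 1 ≤ i ∧ i < n
  · simp [freeToHecke, FGi, h]
  · simp [FGi, Hecke.hgi, Hecke.HGi, h]

theorem freeToHecke_FE {i : ℕ} (h : 1 ≤ i ∧ i < n) : freeToHecke R z n (FE R n i) = 0 := by
  simp [freeToHecke, FE, h]

theorem freeToHecke_eq_of_rel ⦃x y : FreeAlgebra R (Gen n)⦄ (h : Rel R lam laminv del z n x y) :
    freeToHecke R z n x = freeToHecke R z n y := by
  induction h with
  | inv_right i h => simp only [map_mul, map_one, freeToHecke_FG, freeToHecke_FGi, hg_mul_hgi h]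
  | inv_left i h => simp only [map_mul, map_one, freeToHecke_FG, freeToHecke_FGi, hgi_mul_hg h]
  | braid i h => simp only [map_mul, freeToHecke_FG, hg_braid h]
  | comm_gg i j h => simp only [map_mul, freeToHecke_FG, hg_comm h]
  | skein i h =>
    simp only [map_sub, map_smul, map_one, freeToHecke_FG, freeToHecke_FGi, freeToHecke_FE h,
      hg_sub_hgi h, zero_sub, smul_neg]
  | idem i h | untwist_ge i h | untwist_eg i h => simp [freeToHecke_FE h]
  | comm_ge i j h | comm_ee i j h => simp [freeToHecke_FE (n := n) (i := j) (by omega)]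
  | tangle_eee_up i h | tangle_eee_down i h | tangle_gge_up i h | tangle_gge_down i h
  | tangle_egg_up i h | tangle_egg_down i h | untwist_ege_up i h | untwist_ege_down i h =>
    simp [freeToHecke_FE (n := n) (i := i) (by omega),
      freeToHecke_FE (n := n) (i := i + 1) (by omega)]

variable (lam laminv del z n) in
/-- The algebra map `W_{n,R} → H_{n,R}` killing every `e i`. -/
noncomputable def toHecke : Alg R lam laminv del z n →ₐ[R] Hecke.Alg R z n :=
  RingQuot.liftAlgHom R ⟨freeToHecke R z n, freeToHecke_eq_of_rel⟩

theorem toHecke_g (i : ℕ) :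
    toHecke lam laminv del z n (g R lam laminv del z n i) = Hecke.hg R z n i := by
  rw [toHecke, g, RingQuot.liftAlgHom_mkAlgHom_apply, freeToHecke_FG]

theorem toHecke_gi (i : ℕ) :
    toHecke lam laminv del z n (gi R lam laminv del z n i) = Hecke.hgi R z n i := by
  rw [toHecke, gi, RingQuot.liftAlgHom_mkAlgHom_apply, freeToHecke_FGi]

theorem toHecke_e {i : ℕ} (h : 1 ≤ i ∧ i < n) :
    toHecke lam laminv del z n (e R lam laminv del z n i) = 0 := by
  rw [toHecke, e, RingQuot.liftAlgHom_mkAlgHom_apply, freeToHecke_FE h]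

variable (lam laminv del z n) in
/-- The ideal `J_{n,R}` generated by `e (n - 1)`, as a ring congruence. -/
noncomputable abbrev conJ : RingCon (Alg R lam laminv del z n) :=
  (TwoSidedIdeal.span {e R lam laminv del z n (n - 1)}).ringCon

theorem conJ_le_ker_toHecke (hn : 2 ≤ n) :
    conJ lam laminv del z n ≤ RingCon.ker (toHecke lam laminv del z n).toRingHom := by
  have hle : TwoSidedIdeal.span {e R lam laminv del z n (n - 1)} ≤
      TwoSidedIdeal.ker (toHecke lam laminv del z n) := by
    rw [TwoSidedIdeal.span_le]
    rintro _ rfl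
    exact (TwoSidedIdeal.mem_ker _).mpr (toHecke_e (by omega))
  exact TwoSidedIdeal.ringCon_le_iff.mp hle

variable (lam laminv del z) in
/-- The map `W_{n,R} / J_{n,R} → H_{n,R}` induced by `toHecke`. -/
noncomputable def quotientToHecke (hn : 2 ≤ n) :
    (conJ lam laminv del z n).Quotient →ₐ[R] Hecke.Alg R z n :=
  RingCon.liftₐ _ (toHecke lam laminv del z n) (conJ_le_ker_toHecke hn)

variable (lam laminv del z n) in
/-- The quotient map `W_{n,R} → W_{n,R} / J_{n,R}`. -/
noncomputable abbrev mkJ : Alg R lam laminv del z n →ₐ[R] (conJ lam laminv del z n).Quotient :=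
  RingCon.mkₐ R (conJ lam laminv del z n)

theorem mkJ_e {i : ℕ} (h : 1 ≤ i ∧ i < n) :
    mkJ lam laminv del z n (e R lam laminv del z n i) = 0 := by
  rw [← map_zero (mkJ lam laminv del z n)]
  exact (RingCon.eq _).mpr (e_mem_span_e_last h.1 h.2)

/-- The quadratic relation holds modulo `J_{n,R}`. -/
theorem mkJ_g_mul_g {i : ℕ} (h : 1 ≤ i ∧ i < n) :
    mkJ lam laminv del z n (g R lam laminv del z n i * g R lam laminv del z n i) =
      mkJ lam laminv del z n (1 - z • g R lam laminv del z n i) := by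
  have hs : g R lam laminv del z n i * g R lam laminv del z n i =
      1 + z • (e R lam laminv del z n i * g R lam laminv del z n i -
        g R lam laminv del z n i) := by
    have := congrArg (· * g R lam laminv del z n i) (g_sub_gi (lam := lam) (laminv := laminv)
      (del := del) (z := z) h)
    simp only [sub_mul, gi_mul_g h, smul_mul_assoc, one_mul] at this
    rw [← this]
    abel
  rw [hs]
  simp only [map_add, map_sub, map_smul, map_mul, map_one, mkJ_e h, zero_mul, zero_sub, smul_neg]
  abel

variable (lam laminv del z n) in
/-- The map from the free algebra on the Hecke generators to `W_{n,R} / J_{n,R}`. -/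
noncomputable def freeHeckeToQuotient :
    FreeAlgebra R (Hecke.Gen n) →ₐ[R] (conJ lam laminv del z n).Quotient :=
  FreeAlgebra.lift R fun
    | .g i _ => mkJ lam laminv del z n (g R lam laminv del z n i)
    | .gi i _ => mkJ lam laminv del z n (gi R lam laminv del z n i)

theorem freeHeckeToQuotient_HG (i : ℕ) :
    freeHeckeToQuotient lam laminv del z n (Hecke.HG R n i) =
      mkJ lam laminv del z n (g R lam laminv del z n i) := by
  by_cases h : 1 ≤ i ∧ i < n
  · simp only [freeHeckeToQuotient, Hecke.HG, h, and_self, dite_true, FreeAlgebra.lift_ι_apply]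
  · simp only [Hecke.HG, g, FG, h, dite_false, map_one]

theorem freeHeckeToQuotient_HGi (i : ℕ) :
    freeHeckeToQuotient lam laminv del z n (Hecke.HGi R n i) =
      mkJ lam laminv del z n (gi R lam laminv del z n i) := by
  by_cases h : 1 ≤ i ∧ i < n
  · simp only [freeHeckeToQuotient, Hecke.HGi, h, and_self, dite_true, FreeAlgebra.lift_ι_apply]
  · simp only [Hecke.HGi, gi, FGi, h, dite_false, map_one]

theorem freeHeckeToQuotient_eq_of_rel ⦃x y : FreeAlgebra R (Hecke.Gen n)⦄
    (h : Hecke.Rel R z n x y) :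
    freeHeckeToQuotient lam laminv del z n x = freeHeckeToQuotient lam laminv del z n y := by
  induction h with
  | inv_right i h =>
    rw [map_mul, map_one, freeHeckeToQuotient_HG, freeHeckeToQuotient_HGi, ← map_mul, g_mul_gi h,
      map_one]
  | inv_left i h =>
    rw [map_mul, map_one, freeHeckeToQuotient_HG, freeHeckeToQuotient_HGi, ← map_mul, gi_mul_g h,
      map_one]
  | braid i h =>
    simpa only [map_mul, freeHeckeToQuotient_HG] using!
      congrArg (mkJ lam laminv del z n) (g_braid h)
  | comm i j h =>
    simpa only [map_mul, freeHeckeToQuotient_HG] using!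
      congrArg (mkJ lam laminv del z n) (g_comm h)
  | quad i h =>
    rw [map_mul, map_sub, map_smul, map_one, freeHeckeToQuotient_HG, ← map_mul, mkJ_g_mul_g h,
      map_sub, map_smul, map_one]

variable (lam laminv del z n) in
/-- The map `H_{n,R} → W_{n,R} / J_{n,R}` sending generators to generators. -/
noncomputable def heckeToQuotient :
    Hecke.Alg R z n →ₐ[R] (conJ lam laminv del z n).Quotient :=
  RingQuot.liftAlgHom R ⟨freeHeckeToQuotient lam laminv del z n, freeHeckeToQuotient_eq_of_rel⟩

theorem heckeToQuotient_hg (i : ℕ) :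
    heckeToQuotient lam laminv del z n (Hecke.hg R z n i) =
      mkJ lam laminv del z n (g R lam laminv del z n i) := by
  rw [heckeToQuotient, Hecke.hg, RingQuot.liftAlgHom_mkAlgHom_apply, freeHeckeToQuotient_HG]

theorem heckeToQuotient_hgi (i : ℕ) :
    heckeToQuotient lam laminv del z n (Hecke.hgi R z n i) =
      mkJ lam laminv del z n (gi R lam laminv del z n i) := by
  rw [heckeToQuotient, Hecke.hgi, RingQuot.liftAlgHom_mkAlgHom_apply, freeHeckeToQuotient_HGi]

theorem quotientToHecke_mkJ (hn : 2 ≤ n) (x : Alg R lam laminv del z n) :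
    quotientToHecke lam laminv del z hn (mkJ lam laminv del z n x) =
      toHecke lam laminv del z n x :=
  rfl

/-- Algebra maps out of the Hecke algebra agree if they agree on generators. -/
theorem hecke_hom_ext {B : Type*} [Semiring B] [Algebra R B] {f f' : Hecke.Alg R z n →ₐ[R] B}
    (hg : ∀ i, 1 ≤ i ∧ i < n → f (Hecke.hg R z n i) = f' (Hecke.hg R z n i))
    (hgi : ∀ i, 1 ≤ i ∧ i < n → f (Hecke.hgi R z n i) = f' (Hecke.hgi R z n i)) : f = f' := by
  apply RingQuot.ringQuot_ext'
  apply FreeAlgebra.hom_ext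
  funext x
  cases x with
  | g i h => simpa only [Hecke.hg, Hecke.HG, h, and_self, dite_true] using! hg i h
  | gi i h => simpa only [Hecke.hgi, Hecke.HGi, h, and_self, dite_true] using! hgi i h

/-- Algebra maps out of `W_{n,R}` agree if they agree on generators. -/
theorem hom_ext {B : Type*} [Semiring B] [Algebra R B] {f f' : Alg R lam laminv del z n →ₐ[R] B}
    (hg : ∀ i, 1 ≤ i ∧ i < n →
      f (g R lam laminv del z n i) = f' (g R lam laminv del z n i))
    (hgi : ∀ i, 1 ≤ i ∧ i < n →
      f (gi R lam laminv del z n i) = f' (gi R lam laminv del z n i))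
    (he : ∀ i, 1 ≤ i ∧ i < n →
      f (e R lam laminv del z n i) = f' (e R lam laminv del z n i)) : f = f' := by
  apply RingQuot.ringQuot_ext'
  apply FreeAlgebra.hom_ext
  funext x
  cases x with
  | g i h => simpa only [g, FG, h, and_self, dite_true] using! hg i h
  | gi i h => simpa only [gi, FGi, h, and_self, dite_true] using! hgi i h
  | e i h => simpa only [e, FE, h, and_self, dite_true] using! he i h

variable (lam laminv del z) in
/-- The quotient `W_{n,R} / J_{n,R}` is isomorphic to the Hecke algebra. -/
noncomputable def quotientEquivHecke (hn : 2 ≤ n) :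
    (conJ lam laminv del z n).Quotient ≃ₐ[R] Hecke.Alg R z n :=
  AlgEquiv.ofAlgHom (quotientToHecke lam laminv del z hn) (heckeToQuotient lam laminv del z n)
    (hecke_hom_ext
      (fun i _ => by
        rw [AlgHom.comp_apply, heckeToQuotient_hg, quotientToHecke_mkJ, toHecke_g, AlgHom.id_apply])
      (fun i _ => by
        rw [AlgHom.comp_apply, heckeToQuotient_hgi, quotientToHecke_mkJ, toHecke_gi,
          AlgHom.id_apply]))
    (RingCon.Quotient.hom_extₐ (hom_ext
      (fun i _ => by
        rw [AlgHom.comp_apply, AlgHom.comp_apply, quotientToHecke_mkJ, toHecke_g,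
          heckeToQuotient_hg, AlgHom.id_comp])
      (fun i _ => by
        rw [AlgHom.comp_apply, AlgHom.comp_apply, quotientToHecke_mkJ, toHecke_gi,
          heckeToQuotient_hgi, AlgHom.id_comp])
      (fun i h => by
        rw [AlgHom.comp_apply, AlgHom.comp_apply, quotientToHecke_mkJ, toHecke_e h, map_zero,
          AlgHom.id_comp, mkJ_e h])))

end HeckeQuotient

/-- Let `J_{n,R}` be the two-sided ideal of `W_{n,R}` generated by
`e_{n-1}` (`n ≥ 2`).  Then (1) `J_{n,R}` is the two-sided ideal generated by
`{e_1, …, e_{n-1}}`, and (2) the quotient `W_{n,R}/J_{n,R}` is isomorphic as an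
`R`-algebra to the Hecke algebra with the quadratic relation `g_i² = 1 - z g_i`. -/
theorem ideal_J_and_Hecke_quotient
    (R : Type*) [CommRing R] (lam laminv del delinv z : R)
    (hlam : lam * laminv = 1) (hdel : del * delinv = 1)
    (hskein : laminv - lam = z * (del - 1)) (n : ℕ) (hn : 2 ≤ n) :
    (TwoSidedIdeal.span {e R lam laminv del z n (n - 1)} =
        TwoSidedIdeal.span
          {y : Alg R lam laminv del z n | ∃ i : ℕ, 1 ≤ i ∧ i < n ∧
            y = e R lam laminv del z n i}) ∧
      ∃ φ : (TwoSidedIdeal.span {e R lam laminv del z n (n - 1)}).ringCon.Quotient ≃+*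
          Hecke.Alg R z n,
        (∀ r : R,
          φ (RingCon.mk' _ (algebraMap R (Alg R lam laminv del z n) r)) =
            algebraMap R (Hecke.Alg R z n) r) ∧
        (∀ i : ℕ, 1 ≤ i → i < n →
          φ (RingCon.mk' _ (g R lam laminv del z n i)) = Hecke.hg R z n i ∧
          φ (RingCon.mk' _ (gi R lam laminv del z n i)) = Hecke.hgi R z n i) := by
  refine ⟨span_e_last_eq_span_e hn,
    (quotientEquivHecke lam laminv del z hn).toRingEquiv, fun r => ?_, fun i _ _ => ⟨?_, ?_⟩⟩
  · exact (quotientEquivHecke lam laminv del z hn).commutes r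
  · exact toHecke_g i
  · exact toHecke_gi i

end BMW
end

section
/- In W_{2k,R} (k ≥ 1), the element f_k admits the 'diamond' expression f_k = (e_k)(e_{k−1} e_{k+1})(e_{k−2} e_k e_{k+2}) ⋯ (e_1 e_3 ⋯ e_{2k−1}) ⋯ (e_{k−2} e_k e_{k+2})(e_{k−1} e_{k+1})(e_k); that is, f_k = P_1 P_2 ⋯ P_k P_{k−1} ⋯ P_1, where P_j = e_{k−j+1} e_{k−j+3} ⋯ e_{k+j−1} (the product of the e_i with i ranging from k−j+1 to k+j−1 in steps of 2). -/
namespace BMW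

variable (R : Type*) [CommRing R] (lam laminv del z : R) (n : ℕ)

/-- The ascending product `g_1 g_2 ⋯ g_k`. -/
noncomputable def gasc : ℕ → Alg R lam laminv del z n
  | 0 => 1
  | k + 1 => gasc k * g R lam laminv del z n (k + 1)

/-- The descending product `g_k ⋯ g_2 g_1`. -/
noncomputable def gdesc : ℕ → Alg R lam laminv del z n
  | 0 => 1
  | k + 1 => g R lam laminv del z n (k + 1) * gdesc k

/-- The elements `f_k`: `f_1 = e_1` and
`f_k = (g_1 ⋯ g_{2k-2}) f_{k-1} e_{2k-1} (g_{2k-2} ⋯ g_1)` for `k ≥ 2`. -/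
noncomputable def fk : ℕ → Alg R lam laminv del z n
  | 0 => 1
  | 1 => e R lam laminv del z n 1
  | k + 2 =>
      gasc R lam laminv del z n (2 * k + 2) * fk (k + 1) *
        e R lam laminv del z n (2 * k + 3) * gdesc R lam laminv del z n (2 * k + 2)

/-- The product `e_1 e_3 ⋯ e_{2k-1}`. -/
noncomputable def eodd : ℕ → Alg R lam laminv del z n
  | 0 => 1
  | k + 1 => eodd k * e R lam laminv del z n (2 * k + 1)

end BMW

namespace BMW

/-- The column `P_j = e_{k-j+1} e_{k-j+3} ⋯ e_{k+j-1}` of the diamond expression. -/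
noncomputable def Pcol (R : Type*) [CommRing R] (lam laminv del z : R) (n k j : ℕ) :
    Alg R lam laminv del z n :=
  ((List.range j).map (fun t => e R lam laminv del z n (k - j + 1 + 2 * t))).prod

section Relations

variable {R : Type*} [CommRing R] {lam laminv del z : R} {n : ℕ}

local notation "𝐠" => g R lam laminv del z n
local notation "𝐞" => e R lam laminv del z n
local notation "𝐆" => gasc R lam laminv del z n
local notation "𝐃" => gdesc R lam laminv del z n
local notation "𝐏" => Pcol R lam laminv del z n

theorem commute_g_e {i j : ℕ} (hi : 1 ≤ i) (hj : 1 ≤ j) (hin : i < n) (hjn : j < n)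
    (hij : i + 2 ≤ j ∨ j + 2 ≤ i) : Commute (𝐠 i) (𝐞 j) := by
  have := RingQuot.mkAlgHom_rel R
    (Rel.comm_ge (R := R) (lam := lam) (laminv := laminv) (del := del) (z := z) i j
      (n := n) (by omega))
  simp only [map_mul] at this
  exact this

theorem commute_e_e {i j : ℕ} (hi : 1 ≤ i) (hj : 1 ≤ j) (hin : i < n) (hjn : j < n)
    (hij : i + 2 ≤ j ∨ j + 2 ≤ i) : Commute (𝐞 i) (𝐞 j) := by
  have := RingQuot.mkAlgHom_rel R
    (Rel.comm_ee (R := R) (lam := lam) (laminv := laminv) (del := del) (z := z) i j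
      (n := n) (by omega))
  simp only [map_mul] at this
  exact this

theorem g_mul_g_succ_mul_e {i : ℕ} (hi : 1 ≤ i) (hn : i + 1 < n) :
    𝐠 i * 𝐠 (i + 1) * 𝐞 i = 𝐞 (i + 1) * 𝐞 i := by
  have := RingQuot.mkAlgHom_rel R
    (Rel.tangle_gge_up (R := R) (lam := lam) (laminv := laminv) (del := del) (z := z) i
      (n := n) ⟨hi, hn⟩)
  simp only [map_mul] at this
  exact this

theorem g_succ_mul_g_mul_e_succ {i : ℕ} (hi : 1 ≤ i) (hn : i + 1 < n) :
    𝐠 (i + 1) * 𝐠 i * 𝐞 (i + 1) = 𝐞 i * 𝐞 (i + 1) := by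
  have := RingQuot.mkAlgHom_rel R
    (Rel.tangle_gge_down (R := R) (lam := lam) (laminv := laminv) (del := del) (z := z) i
      (n := n) ⟨hi, hn⟩)
  simp only [map_mul] at this
  exact this

theorem e_mul_g_succ_mul_g {i : ℕ} (hi : 1 ≤ i) (hn : i + 1 < n) :
    𝐞 i * 𝐠 (i + 1) * 𝐠 i = 𝐞 i * 𝐞 (i + 1) := by
  have := RingQuot.mkAlgHom_rel R
    (Rel.tangle_egg_up (R := R) (lam := lam) (laminv := laminv) (del := del) (z := z) i
      (n := n) ⟨hi, hn⟩)
  simp only [map_mul] at this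
  exact this

theorem e_succ_mul_g_mul_g_succ {i : ℕ} (hi : 1 ≤ i) (hn : i + 1 < n) :
    𝐞 (i + 1) * 𝐠 i * 𝐠 (i + 1) = 𝐞 (i + 1) * 𝐞 i := by
  have := RingQuot.mkAlgHom_rel R
    (Rel.tangle_egg_down (R := R) (lam := lam) (laminv := laminv) (del := del) (z := z) i
      (n := n) ⟨hi, hn⟩)
  simp only [map_mul] at this
  exact this

theorem gasc_commute_e {m j : ℕ} (hm : m + 2 ≤ j) (hj : j < n) : Commute (𝐆 m) (𝐞 j) := by
  induction m with
  | zero => exact Commute.one_left _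
  | succ m ih =>
    exact (ih (by omega)).mul_left
      (commute_g_e (by omega) (by omega) (by omega) hj (by omega))

theorem gdesc_commute_e {m j : ℕ} (hm : m + 2 ≤ j) (hj : j < n) :
    Commute (𝐃 m) (𝐞 j) := by
  induction m with
  | zero => exact Commute.one_left _
  | succ m ih =>
    exact (commute_g_e (by omega) (by omega) (by omega) hj (by omega)).mul_left
      (ih (by omega))

/-- Conjugation by `g_1 ⋯ g_m` shifts `e_i` to `e_{i+1}`. -/
theorem gasc_semiconjBy_e {m i : ℕ} (hi : 1 ≤ i) (him : i + 1 ≤ m) (hm : m < n) :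
    SemiconjBy (𝐆 m) (𝐞 i) (𝐞 (i + 1)) := by
  induction m, him using Nat.le_induction with
  | base =>
    obtain ⟨i, rfl⟩ : ∃ j, i = j + 1 := ⟨i - 1, by omega⟩
    have h : SemiconjBy (𝐠 (i + 1) * 𝐠 (i + 1 + 1)) (𝐞 (i + 1)) (𝐞 (i + 1 + 1)) := by
      rw [SemiconjBy, g_mul_g_succ_mul_e hi hm, ← mul_assoc, e_succ_mul_g_mul_g_succ hi hm]
    rw [gasc, gasc, mul_assoc]
    exact SemiconjBy.mul_left (gasc_commute_e (by omega) hm) h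
  | succ m him ih =>
    exact (ih (by omega)).mul_left (commute_g_e (by omega) hi hm (by omega) (by omega))

/-- Conjugation by `g_m ⋯ g_1` shifts `e_{i+1}` to `e_i`. -/
theorem gdesc_semiconjBy_e {m i : ℕ} (hi : 1 ≤ i) (him : i + 1 ≤ m) (hm : m < n) :
    SemiconjBy (𝐃 m) (𝐞 (i + 1)) (𝐞 i) := by
  induction m, him using Nat.le_induction with
  | base =>
    obtain ⟨i, rfl⟩ : ∃ j, i = j + 1 := ⟨i - 1, by omega⟩
    have h : SemiconjBy (𝐠 (i + 1 + 1) * 𝐠 (i + 1)) (𝐞 (i + 1 + 1)) (𝐞 (i + 1)) := by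
      rw [SemiconjBy, g_succ_mul_g_mul_e_succ hi hm, ← mul_assoc, e_mul_g_succ_mul_g hi hm]
    rw [gdesc, gdesc, ← mul_assoc]
    exact h.mul_left (gdesc_commute_e (by omega) hm)
  | succ m him ih =>
    exact SemiconjBy.mul_left (commute_g_e (by omega) hi hm (by omega) (by omega))
      (ih (by omega))

theorem semiconjBy_list_prod {M α : Type*} [Monoid M] {a : M} {x y : α → M} {l : List α}
    (h : ∀ t ∈ l, SemiconjBy a (x t) (y t)) :
    SemiconjBy a (l.map x).prod (l.map y).prod := by
  induction l with
  | nil => simp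
  | cons t l ih =>
    rw [List.map_cons, List.map_cons, List.prod_cons, List.prod_cons]
    exact (h t (by simp)).mul_right (ih fun s hs => h s (by simp [hs]))

theorem gasc_semiconjBy_Pcol {k j m : ℕ} (hj : j ≤ k) (hm : k + j ≤ m) (hn : m < n) :
    SemiconjBy (𝐆 m) (𝐏 k j) (𝐏 (k + 1) j) := by
  refine semiconjBy_list_prod fun t ht => ?_
  rw [List.mem_range] at ht
  rw [show k + 1 - j + 1 + 2 * t = k - j + 1 + 2 * t + 1 by omega]
  exact gasc_semiconjBy_e (by omega) (by omega) hn

theorem gdesc_semiconjBy_Pcol {k j m : ℕ} (hj : j ≤ k) (hm : k + j ≤ m) (hn : m < n) :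
    SemiconjBy (𝐃 m) (𝐏 (k + 1) j) (𝐏 k j) := by
  refine semiconjBy_list_prod fun t ht => ?_
  rw [List.mem_range] at ht
  rw [show k + 1 - j + 1 + 2 * t = k - j + 1 + 2 * t + 1 by omega]
  exact gdesc_semiconjBy_e (by omega) (by omega) hn

theorem commute_Pcol {a : Alg R lam laminv del z n} {k j : ℕ}
    (h : ∀ t < j, Commute a (𝐞 (k - j + 1 + 2 * t))) : Commute a (𝐏 k j) :=
  semiconjBy_list_prod fun t ht => h t (List.mem_range.1 ht)

theorem Pcol_self_succ (m : ℕ) : 𝐏 (m + 1) (m + 1) = 𝐏 m m * 𝐞 (2 * m + 1) := by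
  simp [Pcol, List.range_succ, add_comm]

theorem Pcol_succ_succ (m : ℕ) :
    𝐏 (m + 1 + 1) (m + 1) = 𝐏 (m + 1) m * 𝐞 (2 * m + 1 + 1) := by
  simp only [Pcol, List.range_succ, List.map_append, List.prod_append, List.map_singleton,
    List.prod_singleton, show m + 1 + 1 - (m + 1) = 1 by omega, show m + 1 - m = 1 by omega,
    show 1 + 1 + 2 * m = 2 * m + 1 + 1 by omega]

theorem gasc_mul_Pcol {m : ℕ} (hm : 2 * m < n) :
    𝐆 (2 * m) * 𝐏 m m = 𝐏 (m + 1) m * 𝐏 m m := by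
  induction m with
  | zero => simp [gasc, Pcol]
  | succ m ih =>
    have hg : Commute (𝐠 (2 * m + 1) * 𝐠 (2 * m + 1 + 1)) (𝐏 m m) :=
      commute_Pcol fun t ht =>
        (commute_g_e (by omega) (by omega) (by omega) (by omega) (by omega)).mul_left
          (commute_g_e (by omega) (by omega) (by omega) (by omega) (by omega))
    have he : Commute (𝐞 (2 * m + 1 + 1)) (𝐏 m m) :=
      commute_Pcol fun t ht =>
        commute_e_e (by omega) (by omega) (by omega) (by omega) (by omega)
    calc 𝐆 (2 * (m + 1)) * 𝐏 (m + 1) (m + 1)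
        = 𝐆 (2 * m) * ((𝐠 (2 * m + 1) * 𝐠 (2 * m + 1 + 1)) * 𝐏 m m) * 𝐞 (2 * m + 1) := by
          rw [Pcol_self_succ, show 2 * (m + 1) = 2 * m + 1 + 1 by ring, gasc, gasc]
          simp only [mul_assoc]
      _ = (𝐆 (2 * m) * 𝐏 m m) * (𝐠 (2 * m + 1) * 𝐠 (2 * m + 1 + 1) * 𝐞 (2 * m + 1)) := by
          rw [hg.eq]; simp only [mul_assoc]
      _ = 𝐏 (m + 1) m * (𝐏 m m * 𝐞 (2 * m + 1 + 1)) * 𝐞 (2 * m + 1) := by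
          rw [ih (by omega), g_mul_g_succ_mul_e (by omega) (by omega)]
          simp only [mul_assoc]
      _ = _ := by
          rw [← he.eq, Pcol_self_succ, Pcol_succ_succ]; simp only [mul_assoc]

theorem Pcol_mul_gdesc {m : ℕ} (hm : 2 * m < n) :
    𝐏 m m * 𝐃 (2 * m) = 𝐏 m m * 𝐏 (m + 1) m := by
  induction m with
  | zero => simp [gdesc, Pcol]
  | succ m ih =>
    have hg : Commute (𝐞 (2 * m + 1) * 𝐠 (2 * m + 1 + 1) * 𝐠 (2 * m + 1)) (𝐏 m m) :=
      commute_Pcol fun t ht =>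
        ((commute_e_e (by omega) (by omega) (by omega) (by omega) (by omega)).mul_left
          (commute_g_e (by omega) (by omega) (by omega) (by omega) (by omega))).mul_left
          (commute_g_e (by omega) (by omega) (by omega) (by omega) (by omega))
    have he : Commute (𝐞 (2 * m + 1 + 1)) (𝐏 (m + 1) m) :=
      commute_Pcol fun t ht =>
        commute_e_e (by omega) (by omega) (by omega) (by omega) (by omega)
    calc 𝐏 (m + 1) (m + 1) * 𝐃 (2 * (m + 1))
        = (𝐏 m m * (𝐞 (2 * m + 1) * 𝐠 (2 * m + 1 + 1) * 𝐠 (2 * m + 1))) * 𝐃 (2 * m) := by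
          rw [Pcol_self_succ, show 2 * (m + 1) = 2 * m + 1 + 1 by ring, gdesc, gdesc]
          simp only [mul_assoc]
      _ = (𝐞 (2 * m + 1) * 𝐠 (2 * m + 1 + 1) * 𝐠 (2 * m + 1) * 𝐏 m m) * 𝐏 (m + 1) m := by
          rw [← hg.eq, mul_assoc, ih (by omega), mul_assoc _ (𝐏 m m)]
      _ = 𝐏 m m * 𝐞 (2 * m + 1) * (𝐞 (2 * m + 1 + 1) * 𝐏 (m + 1) m) := by
          rw [hg.eq, e_mul_g_succ_mul_g (by omega) (by omega)]
          simp only [mul_assoc]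
      _ = _ := by
          rw [he.eq, Pcol_self_succ, Pcol_succ_succ]

/-- The diamond expression for `f_k` holds in every `W_{n,R}` with `2k ≤ n`. -/
theorem fk_succ_eq_diamond {k : ℕ} (hk : 2 * (k + 1) ≤ n) :
    fk R lam laminv del z n (k + 1) =
      ((List.range k).map fun j => 𝐏 (k + 1) (j + 1)).prod * 𝐏 (k + 1) (k + 1) *
        ((List.range k).reverse.map fun j => 𝐏 (k + 1) (j + 1)).prod := by
  induction k with
  | zero => simp [fk, Pcol]
  | succ k ih =>
    have hU : SemiconjBy (𝐆 (2 * k + 2))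
        ((List.range k).map fun j => 𝐏 (k + 1) (j + 1)).prod
        ((List.range k).map fun j => 𝐏 (k + 1 + 1) (j + 1)).prod :=
      semiconjBy_list_prod fun j hj => by
        rw [List.mem_range] at hj
        exact gasc_semiconjBy_Pcol (by omega) (by omega) (by omega)
    have hV : SemiconjBy (𝐃 (2 * k + 2))
        ((List.range k).reverse.map fun j => 𝐏 (k + 1 + 1) (j + 1)).prod
        ((List.range k).reverse.map fun j => 𝐏 (k + 1) (j + 1)).prod :=
      semiconjBy_list_prod fun j hj => by
        rw [List.mem_reverse, List.mem_range] at hj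
        exact gdesc_semiconjBy_Pcol (by omega) (by omega) (by omega)
    have he : Commute (𝐞 (2 * k + 3))
        ((List.range k).reverse.map fun j => 𝐏 (k + 1) (j + 1)).prod :=
      semiconjBy_list_prod fun j hj => by
        rw [List.mem_reverse, List.mem_range] at hj
        exact commute_Pcol fun t ht =>
          commute_e_e (by omega) (by omega) (by omega) (by omega) (by omega)
    have hL : 𝐆 (2 * k + 2) * 𝐏 (k + 1) (k + 1) =
        𝐏 (k + 1 + 1) (k + 1) * 𝐏 (k + 1) (k + 1) :=
      gasc_mul_Pcol (m := k + 1) (by omega)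
    have hR : 𝐏 (k + 1 + 1) (k + 1 + 1) * 𝐃 (2 * k + 2) =
        𝐏 (k + 1 + 1) (k + 1 + 1) * 𝐏 (k + 1 + 1) (k + 1) := by
      have hE : Commute (𝐞 (2 * (k + 1) + 1)) (𝐏 (k + 1) (k + 1)) :=
        commute_Pcol fun t ht =>
          commute_e_e (by omega) (by omega) (by omega) (by omega) (by omega)
      rw [Pcol_self_succ (k + 1), ← hE.eq, mul_assoc, mul_assoc]
      exact congrArg _ (Pcol_mul_gdesc (m := k + 1) (by omega))
    have hE : 𝐏 (k + 1 + 1) (k + 1 + 1) = 𝐏 (k + 1) (k + 1) * 𝐞 (2 * k + 3) :=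
      Pcol_self_succ (k + 1)
    rw [fk, ih (by omega), List.range_succ, List.reverse_append,
      List.reverse_singleton, List.singleton_append, List.map_append, List.prod_append,
      List.map_singleton, List.prod_singleton, List.map_cons, List.prod_cons]
    set U := ((List.range k).map fun j => 𝐏 (k + 1) (j + 1)).prod
    set U' := ((List.range k).map fun j => 𝐏 (k + 1 + 1) (j + 1)).prod
    set V := ((List.range k).reverse.map fun j => 𝐏 (k + 1) (j + 1)).prod
    set V' := ((List.range k).reverse.map fun j => 𝐏 (k + 1 + 1) (j + 1)).prod
    calc 𝐆 (2 * k + 2) * (U * 𝐏 (k + 1) (k + 1) * V) * 𝐞 (2 * k + 3) * 𝐃 (2 * k + 2)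
        = (𝐆 (2 * k + 2) * U) * 𝐏 (k + 1) (k + 1) * (V * 𝐞 (2 * k + 3)) *
            𝐃 (2 * k + 2) := by simp only [mul_assoc]
      _ = U' * (𝐆 (2 * k + 2) * 𝐏 (k + 1) (k + 1)) * 𝐞 (2 * k + 3) *
            (V * 𝐃 (2 * k + 2)) := by
          rw [hU.eq, ← he.eq]; simp only [mul_assoc]
      _ = U' * 𝐏 (k + 1 + 1) (k + 1) * (𝐏 (k + 1 + 1) (k + 1 + 1) * 𝐃 (2 * k + 2)) *
            V' := by
          rw [hL, ← hV.eq, hE]; simp only [mul_assoc]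
      _ = _ := by rw [hR]; simp only [mul_assoc]

end Relations

/-- In `W_{2k,R}` (`k ≥ 1`), the element `f_k` admits the diamond
expression `f_k = P_1 P_2 ⋯ P_k P_{k-1} ⋯ P_1` where
`P_j = e_{k-j+1} e_{k-j+3} ⋯ e_{k+j-1}`. -/
theorem fk_diamond_expression
    (R : Type*) [CommRing R] (lam laminv del delinv z : R)
    (hlam : lam * laminv = 1) (hdel : del * delinv = 1)
    (hskein : laminv - lam = z * (del - 1)) (k : ℕ) (hk : 1 ≤ k) :
    fk R lam laminv del z (2 * k) k =
      ((List.range k).map (fun j => Pcol R lam laminv del z (2 * k) k (j + 1))).prod *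
        ((List.range (k - 1)).reverse.map
          (fun j => Pcol R lam laminv del z (2 * k) k (j + 1))).prod := by
  obtain ⟨k, rfl⟩ : ∃ m, k = m + 1 := ⟨k - 1, by omega⟩
  rw [fk_succ_eq_diamond le_rfl, List.range_succ, List.map_append, List.prod_append,
    List.map_singleton, List.prod_singleton, Nat.add_sub_cancel]

end BMW
end
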